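/- Let Γ : 𝔤 = ⊕_{j∈ℤ} 𝔤_j be an e-admissible ℤ-grading with e ∈ 𝔤_a (a > 1), and let 𝔫 be a Γ-graded subspace of ⊕_{j<0} 𝔤_j which is a vector space complement of (⊕_{j<0} 𝔤_j) ∩ 𝔤^e in ⊕_{j<0} 𝔤_j and contains ⊕_{j≤−a} 𝔤_j. Then the pair (⊕_{j≤−a} 𝔤_j, 𝔫) is e-admissible if and only if 𝔫 is a Lie subalgebra of 𝔤. In particular, if (⊕_{j<0} 𝔤_j) ∩ 𝔤^e = 0, then (⊕_{j≤−a} 𝔤_j, ⊕_{j<0} 𝔤_j) is the unique e-admissible pair (𝔪,𝔫) relative to Γ with 𝔪 = ⊕_{j≤−a} 𝔤_j. -/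

import Mathlib

open Module LieAlgebra

noncomputable section

variable {L : Type*} [LieRing L] [LieAlgebra ℂ L]

/-- The pair `(𝔪, 𝔫)` of subalgebras is `e`-admissible relative to the `ℤ`-grading
`g : ℤ → Submodule ℂ L` with `e ∈ g a` (`a > 1`): `𝔪`, `𝔫` are Lie subalgebras, are
`Γ`-graded, and conditions (A2)–(A6) of Sadaka's Definition 2.2 hold. -/
def IsAdmissiblePair (g : ℤ → Submodule ℂ L) (e : L) (a : ℤ)
    (m n : Submodule ℂ L) : Prop :=
  -- `𝔪` and `𝔫` are Lie subalgebras of `𝔤`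
  (∀ x ∈ m, ∀ y ∈ m, ⁅x, y⁆ ∈ m) ∧
  (∀ x ∈ n, ∀ y ∈ n, ⁅x, y⁆ ∈ n) ∧
  -- (A2): `𝔪`, `𝔫` are `Γ`-graded and `𝔤_{≤ -a} ⊆ 𝔪 ⊆ 𝔫 ⊆ 𝔤_{<0}`
  m = (⨆ j : ℤ, g j ⊓ m) ∧
  n = (⨆ j : ℤ, g j ⊓ n) ∧
  (⨆ j ≤ -a, g j) ≤ m ∧ m ≤ n ∧ n ≤ (⨆ j < (0:ℤ), g j) ∧
  -- (A3): `𝔪^⊥ ∩ [𝔤, e] = [𝔫, e]`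
  (LinearMap.BilinForm.orthogonal (killingForm ℂ L) m ⊓ LinearMap.range (ad ℂ L e)
      = Submodule.map (ad ℂ L e) n) ∧
  -- (A4): `𝔫 ∩ 𝔤^e = 0`
  n ⊓ LinearMap.ker (ad ℂ L e) = ⊥ ∧
  -- (A5): `[𝔫, 𝔪] ⊆ 𝔪`
  (∀ x ∈ n, ∀ y ∈ m, ⁅x, y⁆ ∈ m) ∧
  -- (A6): `dim 𝔪 + dim 𝔫 = dim 𝔤 - dim 𝔤^e`
  finrank ℂ ↥m + finrank ℂ ↥n
    = finrank ℂ L - finrank ℂ ↥(LinearMap.ker (ad ℂ L e))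

/-- A sum of homogeneous components is a graded subspace. -/
lemma iSup_component_eq_iSup_inf (g : ℤ → Submodule ℂ L) (p : ℤ → Prop) :
    (⨆ j, ⨆ (_ : p j), g j) = ⨆ i, g i ⊓ ⨆ j, ⨆ (_ : p j), g j :=
  le_antisymm
    (iSup₂_le fun j h => le_iSup_of_le j (le_inf le_rfl (le_iSup₂_of_le j h le_rfl)))
    (iSup_le fun _ => inf_le_right)

lemma lie_mem_iSup_component {g : ℤ → Submodule ℂ L}
    (hbr : ∀ i j : ℤ, ∀ x ∈ g i, ∀ y ∈ g j, ⁅x, y⁆ ∈ g (i + j))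
    {p q r : ℤ → Prop} (hpqr : ∀ i j, p i → q j → r (i + j)) {x y : L}
    (hx : x ∈ ⨆ j, ⨆ (_ : p j), g j) (hy : y ∈ ⨆ j, ⨆ (_ : q j), g j) :
    ⁅x, y⁆ ∈ ⨆ j, ⨆ (_ : r j), g j := by
  have hx' : (⨆ j, ⨆ (_ : p j), g j) ≤
      (⨆ j, ⨆ (_ : r j), g j).comap (ad ℂ L y) := by
    refine iSup₂_le fun i hi u hu => ?_
    have hy' : (⨆ j, ⨆ (_ : q j), g j) ≤ (⨆ j, ⨆ (_ : r j), g j).comap (ad ℂ L u) :=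
      iSup₂_le fun j hj v hv =>
        le_iSup₂_of_le (f := fun j (_ : r j) => g j) (i + j) (hpqr i j hi hj) le_rfl
          (hbr i j u hu v hv)
    rw [Submodule.mem_comap, ad_apply, ← lie_skew]
    exact neg_mem (hy' hy)
  rw [← lie_skew]
  exact neg_mem (hx' hx)

lemma killingForm_eq_zero_of_mem_component [FiniteDimensional ℂ L] {g : ℤ → Submodule ℂ L}
    (hInt : DirectSum.IsInternal g)
    (hbr : ∀ i j : ℤ, ∀ x ∈ g i, ∀ y ∈ g j, ⁅x, y⁆ ∈ g (i + j))
    {i j : ℤ} (hij : i + j ≠ 0) {x y : L} (hx : x ∈ g i) (hy : y ∈ g j) :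
    killingForm ℂ L x y = 0 := by
  rw [killingForm_apply_apply]
  refine LinearMap.trace_eq_zero_of_mapsTo_ne hInt (fun k => i + (j + k)) (fun k => by lia)
    fun k z hz => hbr _ _ _ hx _ (hbr _ _ _ hy _ hz)

lemma killingForm_eq_zero_of_mem_iSup_component [FiniteDimensional ℂ L]
    {g : ℤ → Submodule ℂ L} (hInt : DirectSum.IsInternal g)
    (hbr : ∀ i j : ℤ, ∀ x ∈ g i, ∀ y ∈ g j, ⁅x, y⁆ ∈ g (i + j))
    {p q : ℤ → Prop} (hpq : ∀ i j, p i → q j → i + j ≠ 0) {x y : L}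
    (hx : x ∈ ⨆ j, ⨆ (_ : p j), g j) (hy : y ∈ ⨆ j, ⨆ (_ : q j), g j) :
    killingForm ℂ L x y = 0 := by
  have hx' : (⨆ j, ⨆ (_ : p j), g j) ≤ LinearMap.ker ((killingForm ℂ L).flip y) := by
    refine iSup₂_le fun i hi u hu => ?_
    have hy' : (⨆ j, ⨆ (_ : q j), g j) ≤ LinearMap.ker (killingForm ℂ L u) :=
      iSup₂_le fun j hj v hv =>
        killingForm_eq_zero_of_mem_component hInt hbr (hpq i j hi hj) hu hv
    exact hy' hy
  exact hx' hx

lemma iSup_component_sup_compl {g : ℤ → Submodule ℂ L} (hInt : DirectSum.IsInternal g)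
    (p : ℤ → Prop) :
    (⨆ j, ⨆ (_ : p j), g j) ⊔ (⨆ j, ⨆ (_ : ¬ p j), g j) = ⊤ := by
  rw [← top_le_iff, ← hInt.submodule_iSup_eq_top]
  refine iSup_le fun j => ?_
  by_cases hj : p j
  · exact le_sup_of_le_left (le_iSup₂_of_le j hj le_rfl)
  · exact le_sup_of_le_right (le_iSup₂_of_le j hj le_rfl)

lemma range_ad_eq_orthogonal_ker [FiniteDimensional ℂ L] [IsKilling ℂ L] (e : L) :
    LinearMap.range (ad ℂ L e) =
      LinearMap.BilinForm.orthogonal (killingForm ℂ L) (LinearMap.ker (ad ℂ L e)) := by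
  apply Submodule.eq_of_le_of_finrank_eq
  · rintro _ ⟨x, rfl⟩ z hz
    have hz' : ⁅z, e⁆ = 0 := by rw [← lie_skew, ← ad_apply (R := ℂ), hz, neg_zero]
    change killingForm ℂ L z ⁅e, x⁆ = 0
    rw [← LieModule.traceForm_apply_lie_apply, hz', map_zero, LinearMap.zero_apply]
  · have h := (ad ℂ L e).finrank_range_add_finrank_ker
    rw [LinearMap.BilinForm.finrank_orthogonal (IsKilling.killingForm_nondegenerate ℂ L)]
    lia

/-- If `𝔲 ∩ 𝔤^e = 0` then `𝔲^⊥ ∩ [𝔤, e] = (𝔲 ⊕ 𝔤^e)^⊥` has codimension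
`dim 𝔲 + dim 𝔤^e`. -/
lemma finrank_orthogonal_inf_range_ad [FiniteDimensional ℂ L] [IsKilling ℂ L] (e : L)
    {u : Submodule ℂ L} (hu : u ⊓ LinearMap.ker (ad ℂ L e) = ⊥) :
    finrank ℂ u + finrank ℂ ↥(LinearMap.BilinForm.orthogonal (killingForm ℂ L) u ⊓
      LinearMap.range (ad ℂ L e)) =
      finrank ℂ L - finrank ℂ (LinearMap.ker (ad ℂ L e)) := by
  have hsup : LinearMap.BilinForm.orthogonal (killingForm ℂ L) u ⊓
      LinearMap.range (ad ℂ L e) = LinearMap.BilinForm.orthogonal (killingForm ℂ L)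
        (u ⊔ LinearMap.ker (ad ℂ L e)) := by
    rw [range_ad_eq_orthogonal_ker]
    refine le_antisymm (fun x hx y hy => ?_) (le_inf
      (LinearMap.BilinForm.orthogonal_le le_sup_left)
      (LinearMap.BilinForm.orthogonal_le le_sup_right))
    obtain ⟨v, hv, w, hw, rfl⟩ := Submodule.mem_sup.mp hy
    have hvx : killingForm ℂ L v x = 0 := hx.1 v hv
    have hwx : killingForm ℂ L w x = 0 := hx.2 w hw
    change killingForm ℂ L (v + w) x = 0
    rw [map_add, LinearMap.add_apply, hvx, hwx, add_zero]
  have hdim := Submodule.finrank_sup_add_finrank_inf_eq u (LinearMap.ker (ad ℂ L e))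
  rw [hu, finrank_bot] at hdim
  have hle := (u ⊔ LinearMap.ker (ad ℂ L e)).finrank_le
  rw [hsup, LinearMap.BilinForm.finrank_orthogonal (IsKilling.killingForm_nondegenerate ℂ L)]
  lia

lemma orthogonal_iSup_le_neg_inf_range_ad [FiniteDimensional ℂ L] [IsKilling ℂ L]
    {g : ℤ → Submodule ℂ L} (hInt : DirectSum.IsInternal g)
    (hbr : ∀ i j : ℤ, ∀ x ∈ g i, ∀ y ∈ g j, ⁅x, y⁆ ∈ g (i + j))
    {e : L} {a : ℤ} (hea : e ∈ g a) :
    LinearMap.BilinForm.orthogonal (killingForm ℂ L) (⨆ j ≤ -a, g j) ⊓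
      LinearMap.range (ad ℂ L e) = Submodule.map (ad ℂ L e) (⨆ j < (0 : ℤ), g j) := by
  have he : e ∈ ⨆ j, ⨆ (_ : j = a), g j := by simpa using hea
  have hneg : ∀ x ∈ ⨆ j < (0 : ℤ), g j,
      ⁅e, x⁆ ∈ LinearMap.BilinForm.orthogonal (killingForm ℂ L) (⨆ j ≤ -a, g j) :=
    fun x hx v hv => killingForm_eq_zero_of_mem_iSup_component hInt hbr
      (p := fun j => j ≤ -a) (q := fun j => j < a) (fun i j hi hj => by lia) hv
      (lie_mem_iSup_component hbr (q := fun j => j < 0) (fun i j hi hj => by lia) he hx)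
  refine le_antisymm ?_ ?_
  · rintro _ ⟨hy, x, rfl⟩
    obtain ⟨x₁, hx₁, x₂, hx₂, rfl⟩ := Submodule.mem_sup.mp
      ((iSup_component_sup_compl hInt (fun j => j < 0)).ge (Submodule.mem_top (x := x)))
    have hortho : ⁅e, x₂⁆ ∈
        LinearMap.BilinForm.orthogonal (killingForm ℂ L) (⨆ j ≤ -a, g j) := by
      have h := sub_mem hy (hneg x₁ hx₁)
      rwa [map_add, ad_apply, ad_apply, add_sub_cancel_left] at h
    have hzero : ⁅e, x₂⁆ = 0 := by
      rw [← Submodule.mem_bot ℂ,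
        ← LinearMap.BilinForm.orthogonal_top_eq_bot
          (IsKilling.killingForm_nondegenerate ℂ L)]
      rintro z -
      obtain ⟨v, hv, w, hw, rfl⟩ := Submodule.mem_sup.mp
        ((iSup_component_sup_compl hInt (fun j => j ≤ -a)).ge (Submodule.mem_top (x := z)))
      have hv0 : killingForm ℂ L v ⁅e, x₂⁆ = 0 := hortho v hv
      have hw0 : killingForm ℂ L w ⁅e, x₂⁆ = 0 :=
        killingForm_eq_zero_of_mem_iSup_component hInt hbr (q := fun j => a ≤ j)
          (fun i j hi hj => by lia) hw
          (lie_mem_iSup_component hbr (fun i j hi hj => by lia) he hx₂)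
      change killingForm ℂ L (v + w) ⁅e, x₂⁆ = 0
      rw [map_add, LinearMap.add_apply, hv0, hw0, add_zero]
    exact ⟨x₁, hx₁, by rw [map_add, ad_apply, ad_apply, hzero, add_zero]⟩
  · rintro _ ⟨x, hx, rfl⟩
    exact ⟨hneg x hx, x, rfl⟩

/-- A graded Lie subalgebra `𝔫` with `𝔤_{≤-a} ⊆ 𝔫 ⊆ 𝔤_{<0}` that is a complement of
`𝔤_{<0} ∩ 𝔤^e` in `𝔤_{<0}` forms an `e`-admissible pair with `𝔤_{≤-a}`. -/
lemma isAdmissiblePair_of_isCompl [FiniteDimensional ℂ L] [IsKilling ℂ L]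
    {g : ℤ → Submodule ℂ L} (hInt : DirectSum.IsInternal g)
    (hbr : ∀ i j : ℤ, ∀ x ∈ g i, ∀ y ∈ g j, ⁅x, y⁆ ∈ g (i + j))
    {e : L} {a : ℤ} (hea : e ∈ g a) {n : Submodule ℂ L}
    (hng : n = ⨆ j : ℤ, g j ⊓ n)
    (hn1 : (⨆ j ≤ -a, g j) ≤ n) (hn2 : n ≤ ⨆ j < (0 : ℤ), g j)
    (hc1 : n ⊓ ((⨆ j < (0 : ℤ), g j) ⊓ LinearMap.ker (ad ℂ L e)) = ⊥)
    (hc2 : n ⊔ ((⨆ j < (0 : ℤ), g j) ⊓ LinearMap.ker (ad ℂ L e)) = ⨆ j < (0 : ℤ), g j)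
    (hlie : ∀ x ∈ n, ∀ y ∈ n, ⁅x, y⁆ ∈ n) :
    IsAdmissiblePair g e a (⨆ j ≤ -a, g j) n := by
  have hker : n ⊓ LinearMap.ker (ad ℂ L e) = ⊥ := by
    rwa [← inf_assoc, inf_eq_left.mpr hn2] at hc1
  have hmap : LinearMap.BilinForm.orthogonal (killingForm ℂ L) (⨆ j ≤ -a, g j) ⊓
      LinearMap.range (ad ℂ L e) = Submodule.map (ad ℂ L e) n := by
    rw [orthogonal_iSup_le_neg_inf_range_ad hInt hbr hea, ← hc2, Submodule.map_sup,
      sup_eq_left]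
    rintro _ ⟨x, hx, rfl⟩
    rw [hx.2]
    exact zero_mem _
  have hlow : ∀ x ∈ n, ∀ y ∈ ⨆ j ≤ -a, g j, ⁅x, y⁆ ∈ ⨆ j ≤ -a, g j := fun x hx y hy =>
    lie_mem_iSup_component hbr (p := fun j => j < 0) (q := fun j => j ≤ -a)
      (r := fun j => j ≤ -a) (fun i j hi hj => by lia) (hn2 hx) hy
  refine ⟨fun x hx => hlow x (hn1 hx), hlie, iSup_component_eq_iSup_inf g (fun j => j ≤ -a),
    hng, le_rfl, hn1, hn2, hmap, hker, hlow, ?_⟩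
  have hinj : Function.Injective ((ad ℂ L e).domRestrict n) :=
    LinearMap.injective_domRestrict_iff.mpr (disjoint_iff.mpr hker)
  rw [← finrank_orthogonal_inf_range_ad e
    (le_bot_iff.mp ((inf_le_inf_right _ hn1).trans hker.le)), hmap,
    ← LinearMap.range_domRestrict, LinearMap.finrank_range_of_inj hinj]

/-- **Proposition 2.12 (Sadaka).** Let `Γ` be an `e`-admissible `ℤ`-grading with `e ∈ 𝔤_a`
(`a > 1`), and let `𝔫` be a `Γ`-graded subspace of `𝔤_{<0}`, containing `𝔤_{≤−a}`, which is
a vector space complement of `𝔤_{<0} ∩ 𝔤^e` in `𝔤_{<0}`.  Then `(𝔤_{≤−a}, 𝔫)` is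
`e`-admissible iff `𝔫` is a Lie subalgebra.  In particular, if `𝔤_{<0} ∩ 𝔤^e = 0` then
`(𝔤_{≤−a}, 𝔤_{<0})` is the unique `e`-admissible pair whose first member is `𝔤_{≤−a}`. -/
theorem stmt_4 {L : Type*} [LieRing L] [LieAlgebra ℂ L]
    [FiniteDimensional ℂ L] [LieAlgebra.IsSimple ℂ L]
    (e : L) (he : IsNilpotent (ad ℂ L e))
    (g : ℤ → Submodule ℂ L)
    (hInt : DirectSum.IsInternal g)
    (hbr : ∀ i j : ℤ, ∀ x ∈ g i, ∀ y ∈ g j, ⁅x, y⁆ ∈ g (i + j))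
    (a : ℤ) (ha : 1 < a) (hea : e ∈ g a)
    (hadm : ∃ m n : Submodule ℂ L, IsAdmissiblePair g e a m n)
    (n : Submodule ℂ L)
    (hng : n = (⨆ j : ℤ, g j ⊓ n))
    (hn1 : (⨆ j ≤ -a, g j) ≤ n) (hn2 : n ≤ (⨆ j < (0:ℤ), g j))
    (hc1 : n ⊓ ((⨆ j < (0:ℤ), g j) ⊓ LinearMap.ker (ad ℂ L e)) = ⊥)
    (hc2 : n ⊔ ((⨆ j < (0:ℤ), g j) ⊓ LinearMap.ker (ad ℂ L e)) = (⨆ j < (0:ℤ), g j)) :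
    (IsAdmissiblePair g e a (⨆ j ≤ -a, g j) n ↔ ∀ x ∈ n, ∀ y ∈ n, ⁅x, y⁆ ∈ n) ∧
    ((⨆ j < (0:ℤ), g j) ⊓ LinearMap.ker (ad ℂ L e) = ⊥ →
      IsAdmissiblePair g e a (⨆ j ≤ -a, g j) (⨆ j < (0:ℤ), g j) ∧
      ∀ n' : Submodule ℂ L, IsAdmissiblePair g e a (⨆ j ≤ -a, g j) n' →
        n' = (⨆ j < (0:ℤ), g j)) := by
  refine ⟨⟨fun h => h.2.1,
    isAdmissiblePair_of_isCompl hInt hbr hea hng hn1 hn2 hc1 hc2⟩, fun h0 => ?_⟩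
  refine ⟨isAdmissiblePair_of_isCompl hInt hbr hea
    (iSup_component_eq_iSup_inf g (fun j => j < 0)) (hn1.trans hn2) le_rfl (by rw [h0, inf_bot_eq])
    (by rw [h0, sup_bot_eq]) fun x hx y hy => lie_mem_iSup_component hbr
      (p := fun j => j < 0) (q := fun j => j < 0) (r := fun j => j < 0)
      (fun i j hi hj => by lia) hx hy, ?_⟩
  rintro n' ⟨-, -, -, -, -, -, hn', hmap, -⟩
  rw [orthogonal_iSup_le_neg_inf_range_ad hInt hbr hea] at hmap
  refine le_antisymm hn' fun x hx => ?_
  obtain ⟨y, hy, hyx⟩ := hmap.le (Submodule.mem_map_of_mem hx)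
  have hxy : y - x ∈ (⨆ j < (0:ℤ), g j) ⊓ LinearMap.ker (ad ℂ L e) :=
    ⟨sub_mem (hn' hy) hx, LinearMap.sub_mem_ker_iff.mpr hyx⟩
  rw [h0, Submodule.mem_bot, sub_eq_zero] at hxy
  exact hxy ▸ hy
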